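/- arXiv:2105.12299 — 8 statements merged into one kernel-verified Lean document; each statement's English description precedes it below -/
import Mathlib

section
/- Let d ≥ 1 be a natural number, let v be a real number with v > 2d + 2, set ρ = v - 2d - 2, and let C₁ and C₂ be symmetric positive definite d×d real matrices such that (ρ + d + 1)·(det(C₁·C₂))^{1/d} - ρ > 0. Define ν = 2d + 2 + (d+1)·ρ / ((ρ + d + 1)·(det(C₁·C₂))^{1/d} - ρ). Then ν > 2d + 2, and the following determinant (volume-matching) equality holds: det( ((ν - d - 1)/((v - d - 1)(ν - 2d - 2))) · C₁⁻¹ ) = det( (1/(v - 2d - 2)) · C₂ ). -/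
/-- **Theorem 1 (volume matching).** Matching the determinant of the expected extent
matrices forces the closed-form predicted degrees of freedom. -/
theorem closed_form_dof_volume_matching
    (d : ℕ) (hd : 1 ≤ d) (v : ℝ) (hv : v > 2 * d + 2)
    (C₁ C₂ : Matrix (Fin d) (Fin d) ℝ) (hC₁ : C₁.PosDef) (hC₂ : C₂.PosDef)
    (ρ : ℝ) (hρ : ρ = v - 2 * d - 2)
    (hpos : (ρ + d + 1) * ((C₁ * C₂).det) ^ ((1 : ℝ) / d) - ρ > 0)
    (ν : ℝ)
    (hν : ν = 2 * d + 2 +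
      (d + 1) * ρ / ((ρ + d + 1) * ((C₁ * C₂).det) ^ ((1 : ℝ) / d) - ρ)) :
    ν > 2 * d + 2 ∧
      (((ν - d - 1) / ((v - d - 1) * (ν - 2 * d - 2))) • C₁⁻¹).det =
        ((1 / (v - 2 * d - 2)) • C₂).det := by
  have hρ0 : 0 < ρ := by linarith
  have h₁ : 0 < C₁.det := hC₁.det_pos
  have h₂ : 0 < C₂.det := hC₂.det_pos
  have hdet : 0 < (C₁ * C₂).det := by rw [Matrix.det_mul]; positivity
  have hpow : (((C₁ * C₂).det) ^ ((1 : ℝ) / d)) ^ d = C₁.det * C₂.det := by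
    rw [one_div, Real.rpow_inv_natCast_pow hdet.le (by omega), Matrix.det_mul]
  set t := ((C₁ * C₂).det) ^ ((1 : ℝ) / d)
  have hfrac : 0 < (d + 1) * ρ / ((ρ + d + 1) * t - ρ) := by positivity
  refine ⟨by linarith, ?_⟩
  have hscalar : (ν - d - 1) / ((v - d - 1) * (ν - 2 * d - 2)) = t / ρ := by
    have hv' : v - d - 1 = ρ + d + 1 := by linarith
    have hν' : ν - 2 * d - 2 = (d + 1) * ρ / ((ρ + d + 1) * t - ρ) := by linarith
    have hρd : ρ + d + 1 ≠ 0 := by positivity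
    rw [div_eq_div_iff (mul_ne_zero (hv' ▸ hρd) (hν' ▸ hfrac.ne')) hρ0.ne', hv', hν', hν]
    field_simp [hpos.ne']
    ring
  rw [hscalar, ← hρ, Matrix.det_smul, Matrix.det_smul, Fintype.card_fin,
    Matrix.det_nonsing_inv, Ring.inverse_eq_inv', div_pow, hpow, div_pow, one_pow]
  field_simp
end

section
/- Let d ≥ 1 be a natural number, let v be a real number with v > 2d + 2, set ρ = v - 2d - 2, and let C₁ and C₂ be symmetric positive definite d×d real matrices satisfying det(C₁)·det(C₂) ≥ 1. Then (ρ + d + 1)·(det(C₁·C₂))^{1/d} - ρ ≥ d + 1 > 0, and the closed-form degrees of freedom ν = 2d + 2 + (d+1)·ρ / ((ρ + d + 1)·(det(C₁·C₂))^{1/d} - ρ) satisfies 2d + 2 < ν ≤ v. -/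
/-- The closed-form predicted degrees of freedom always satisfy `2d + 2 < ν ≤ v`
when `det C₁ · det C₂ ≥ 1` (which holds by Jensen's inequality). -/
theorem closed_form_dof_bounds
    (d : ℕ) (hd : 1 ≤ d) (v : ℝ) (hv : v > 2 * d + 2)
    (C₁ C₂ : Matrix (Fin d) (Fin d) ℝ) (hC₁ : C₁.PosDef) (hC₂ : C₂.PosDef)
    (ρ : ℝ) (hρ : ρ = v - 2 * d - 2)
    (hdet : C₁.det * C₂.det ≥ 1)
    (ν : ℝ)
    (hν : ν = 2 * d + 2 +
      (d + 1) * ρ / ((ρ + d + 1) * ((C₁ * C₂).det) ^ ((1 : ℝ) / d) - ρ)) :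
    ((ρ + d + 1) * ((C₁ * C₂).det) ^ ((1 : ℝ) / d) - ρ ≥ d + 1 ∧ (0 : ℝ) < d + 1) ∧
      2 * d + 2 < ν ∧ ν ≤ v := by
  have hd0 : (0 : ℝ) ≤ d := Nat.cast_nonneg d
  have hρ0 : 0 < ρ := by linarith
  have hroot : 1 ≤ ((C₁ * C₂).det) ^ ((1 : ℝ) / d) :=
    Real.one_le_rpow (by rw [Matrix.det_mul]; exact hdet) (by positivity)
  have hden : (ρ + d + 1) * ((C₁ * C₂).det) ^ ((1 : ℝ) / d) - ρ ≥ d + 1 := by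
    have := le_mul_of_one_le_right (by linarith : 0 ≤ ρ + d + 1) hroot
    linarith
  have hd1 : (0 : ℝ) < d + 1 := by linarith
  have hden0 := hd1.trans_le hden
  refine ⟨⟨hden, hd1⟩, ?_, ?_⟩
  · have := div_pos (mul_pos hd1 hρ0) hden0
    linarith
  · have := (div_le_iff₀ hden0).mpr
      ((mul_comm _ _).trans_le (mul_le_mul_of_nonneg_left hden hρ0.le))
    linarith
end

section
/- Let d ≥ 1 be a natural number, let (α, μ) be a probability space, and let A : α → Matrix (Fin d) (Fin d) ℝ be a measurable function such that A(x) is symmetric positive definite for every x, and such that both x ↦ A(x) and x ↦ (A(x))⁻¹ are (entrywise) integrable with respect to μ. Then the matrix (∫ (A(x))⁻¹ dμ(x)) - (∫ A(x) dμ(x))⁻¹ is positive semidefinite, and consequently det(∫ (A(x))⁻¹ dμ(x)) · det(∫ A(x) dμ(x)) ≥ 1. -/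
open MeasureTheory

/-- The measurable space of matrices, with the product σ-algebra (entrywise). -/
instance matrixMeasurableSpace (m n α : Type*) [MeasurableSpace α] :
    MeasurableSpace (Matrix m n α) :=
  inferInstanceAs (MeasurableSpace (m → n → α))

namespace Matrix

section Integral

variable {n α : Type*} [MeasurableSpace α] {μ : Measure α} {M : α → Matrix n n ℝ}

lemma isHermitian_integral (hM : ∀ x, (M x).IsHermitian) :
    (of fun i j => ∫ x, M x i j ∂μ).IsHermitian := by
  ext i j
  simp only [conjTranspose_apply, of_apply, star_trivial]
  exact integral_congr_ae (.of_forall fun x => by simpa using (hM x).apply i j)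

variable [Fintype n]

lemma integrable_dotProduct_mulVec (hint : ∀ i j, Integrable (fun x => M x i j) μ) (v : n → ℝ) :
    Integrable (fun x => v ⬝ᵥ (M x *ᵥ v)) μ := by
  simp only [dotProduct, mulVec]
  exact integrable_finsetSum _ fun i _ =>
    (integrable_finsetSum _ fun j _ => (hint i j).mul_const _).const_mul _

lemma dotProduct_integral_mulVec (hint : ∀ i j, Integrable (fun x => M x i j) μ) (v : n → ℝ) :
    v ⬝ᵥ ((of fun i j => ∫ x, M x i j ∂μ) *ᵥ v) = ∫ x, v ⬝ᵥ (M x *ᵥ v) ∂μ := by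
  simp only [dotProduct, mulVec, of_apply]
  rw [integral_finsetSum _ fun i _ =>
    (integrable_finsetSum _ fun j _ => (hint i j).mul_const _).const_mul _]
  refine Finset.sum_congr rfl fun i _ => ?_
  rw [integral_const_mul, integral_finsetSum _ fun j _ => (hint i j).mul_const _]
  simp only [integral_mul_const]

/-- The entrywise integral of positive semidefinite matrices is positive semidefinite. -/
lemma posSemidef_integral (hM : ∀ x, (M x).PosSemidef)
    (hint : ∀ i j, Integrable (fun x => M x i j) μ) :
    (of fun i j => ∫ x, M x i j ∂μ).PosSemidef := by
  refine .of_dotProduct_mulVec_nonneg (isHermitian_integral fun x => (hM x).1) fun v => ?_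
  rw [star_trivial, dotProduct_integral_mulVec hint]
  exact integral_nonneg fun x => by simpa using (hM x).dotProduct_mulVec_nonneg v

/-- The entrywise integral of positive definite matrices against a nonzero measure is positive
definite. -/
lemma posDef_integral [NeZero μ] (hM : ∀ x, (M x).PosDef)
    (hint : ∀ i j, Integrable (fun x => M x i j) μ) :
    (of fun i j => ∫ x, M x i j ∂μ).PosDef := by
  refine .of_dotProduct_mulVec_pos (isHermitian_integral fun x => (hM x).1) fun v hv => ?_
  have hpos x : 0 < v ⬝ᵥ (M x *ᵥ v) := by simpa using (hM x).dotProduct_mulVec_pos hv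
  rw [star_trivial, dotProduct_integral_mulVec hint,
    integral_pos_iff_support_of_nonneg (fun x => (hpos x).le) (integrable_dotProduct_mulVec hint v),
    Function.support_eq_univ fun x => (hpos x).ne']
  exact NeZero.pos _

end Integral

variable {n : Type*} [Fintype n] [DecidableEq n]

lemma PosDef.posSemidef_fromBlocks_inv {A : Matrix n n ℝ} (hA : A.PosDef) :
    (fromBlocks A⁻¹ 1 1 A).PosSemidef := by
  have := hA.isUnit.invertible
  simpa using (PosDef.fromBlocks₂₂ A⁻¹ 1 hA).2 (by simpa using PosSemidef.zero)

lemma PosSemidef.one_le_det_one_add {Q : Matrix n n ℝ} (hQ : Q.PosSemidef) :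
    1 ≤ (1 + Q).det := by
  have h : (1 + Q).det = ∏ i, (1 + hQ.1.eigenvalues i) := by
    conv_lhs => rw [hQ.1.spectral_theorem, Unitary.conjStarAlgAut_apply, mul_assoc,
      det_one_add_mul_comm, mul_assoc, Unitary.coe_star_mul_self, mul_one, ← diagonal_one,
      diagonal_add, det_diagonal]
    simp
  rw [h]
  calc (1 : ℝ) = ∏ _i : n, 1 := Finset.prod_const_one.symm
    _ ≤ ∏ i, (1 + hQ.1.eigenvalues i) := Finset.prod_le_prod (fun _ _ => zero_le_one)
      fun i _ => le_add_of_nonneg_right (hQ.eigenvalues_nonneg i)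

lemma PosDef.one_le_det_mul_det {B C : Matrix n n ℝ} (hB : B.PosDef)
    (h : (C - B⁻¹).PosSemidef) : 1 ≤ C.det * B.det := by
  obtain ⟨Y, hY, rfl⟩ : ∃ Y : Matrix n n ℝ, IsUnit Y ∧ B = Yᴴ * Y := by
    open scoped MatrixOrder Matrix.Norms.L2Operator in
    exact CStarAlgebra.isStrictlyPositive_iff_eq_star_mul_self.mp hB.isStrictlyPositive
  rw [isUnit_iff_isUnit_det] at hY
  have hY' : IsUnit Yᴴ.det := by rwa [det_conjTranspose, star_trivial]
  have hQ : 1 + Y * (C - (Yᴴ * Y)⁻¹) * Yᴴ = Y * C * Yᴴ := by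
    rw [mul_inv_rev, mul_sub, sub_mul, ← mul_assoc Y, mul_nonsing_inv _ hY, one_mul,
      nonsing_inv_mul _ hY', add_sub_cancel]
  calc 1 ≤ (1 + Y * (C - (Yᴴ * Y)⁻¹) * Yᴴ).det :=
        (h.mul_mul_conjTranspose_same Y).one_le_det_one_add
    _ = C.det * (Yᴴ * Y).det := by rw [hQ]; simp only [det_mul]; ring

end Matrix

/-- **Matrix Jensen inequality.** For a random positive definite matrix `A`,
`E[A⁻¹] - (E[A])⁻¹` is positive semidefinite, and hence
`det E[A⁻¹] · det E[A] ≥ 1`. Integrals of matrix-valued maps are entrywise. -/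
theorem matrix_jensen_inverse
    (d : ℕ) (hd : 1 ≤ d) {α : Type*} [MeasurableSpace α]
    (μ : Measure α) [IsProbabilityMeasure μ]
    (A : α → Matrix (Fin d) (Fin d) ℝ) (hmeas : Measurable A)
    (hpos : ∀ x, (A x).PosDef)
    (hintA : ∀ i j, Integrable (fun x => A x i j) μ)
    (hintAinv : ∀ i j, Integrable (fun x => (A x)⁻¹ i j) μ) :
    (Matrix.of (fun i j => ∫ x, (A x)⁻¹ i j ∂μ) -
        (Matrix.of (fun i j => ∫ x, A x i j ∂μ))⁻¹).PosSemidef ∧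
      (Matrix.of (fun i j => ∫ x, (A x)⁻¹ i j ∂μ)).det *
        (Matrix.of (fun i j => ∫ x, A x i j ∂μ)).det ≥ 1 := by
  have hB := Matrix.posDef_integral hpos hintA
  have hblock := Matrix.posSemidef_integral (μ := μ)
    (fun x => (hpos x).posSemidef_fromBlocks_inv) (by
      rintro (i | i) (j | j)
      · exact hintAinv i j
      · exact integrable_const _
      · exact integrable_const _
      · exact hintA i j)
  have hS : (Matrix.of (fun i j => ∫ x, (A x)⁻¹ i j ∂μ) -
      (Matrix.of (fun i j => ∫ x, A x i j ∂μ))⁻¹).PosSemidef := by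
    have := hB.isUnit.invertible
    have key := Matrix.PosDef.fromBlocks₂₂ (Matrix.of (fun i j => ∫ x, (A x)⁻¹ i j ∂μ)) 1 hB
    rw [one_mul, Matrix.conjTranspose_one, mul_one] at key
    refine key.1 ((congrArg Matrix.PosSemidef ?_).mp hblock)
    ext (i | i) (j | j) <;> simp [Matrix.one_apply]
  exact ⟨hS, hB.one_le_det_mul_det hS⟩
end

section
/- Let d ≥ 1 be a natural number and let ν be a real number with ν > 2d. Then ∑_{i=1}^{d} ψ₁((ν - d - i)/2) > 2d/(ν - d - 1), where ψ₁ is the trigamma function. -/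
/-- The trigamma function, `ψ₁(x) = ∑_{n=0}^∞ 1/(x+n)²`. -/
noncomputable def trigamma (x : ℝ) : ℝ := ∑' n : ℕ, 1 / (x + n) ^ 2

theorem hasSum_one_div_add_sub_one_div_add_succ {x : ℝ} (hx : 0 < x) :
    HasSum (fun n : ℕ => 1 / (x + n) - 1 / (x + (n + 1 : ℕ))) (1 / x) := by
  rw [hasSum_iff_tendsto_nat_of_nonneg]
  · have h : Filter.Tendsto (fun n : ℕ => 1 / (x + n)) Filter.atTop (nhds 0) := by
      simpa only [one_div, Function.comp_def] using tendsto_inv_atTop_zero.comp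
        (Filter.tendsto_atTop_add_const_left _ x tendsto_natCast_atTop_atTop)
    simp_rw [Finset.sum_range_sub' (fun n : ℕ => 1 / (x + n))]
    simpa using h.const_sub (1 / x)
  · intro n
    rw [sub_nonneg]
    gcongr
    omega

theorem summable_one_div_add_sq (x : ℝ) : Summable fun n : ℕ => 1 / (x + n) ^ 2 := by
  have h := (Real.summable_one_div_nat_add_rpow x 2).2 one_lt_two
  simpa [Real.rpow_two, sq_abs, add_comm] using h

theorem one_div_lt_trigamma {x : ℝ} (hx : 0 < x) : 1 / x < trigamma x := by
  have hlt (n : ℕ) : 1 / (x + n) - 1 / (x + (n + 1 : ℕ)) < 1 / (x + n) ^ 2 := by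
    have hn : 0 < x + n := by positivity
    push_cast
    rw [← add_assoc, div_sub_div _ _ hn.ne' (by positivity), div_lt_div_iff₀ (by positivity)
      (by positivity)]
    nlinarith
  exact hasSum_lt (fun n => (hlt n).le) (hlt 0) (hasSum_one_div_add_sub_one_div_add_succ hx)
    (summable_one_div_add_sq x).hasSum

/-- **Lemma 6.** For `d ≥ 1` and `ν > 2d`,
`∑_{i=1}^{d} ψ₁((ν - d - i)/2) > 2d/(ν - d - 1)`. -/
theorem trigamma_sum_inequality
    (d : ℕ) (hd : 1 ≤ d) (ν : ℝ) (hν : ν > 2 * d) :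
    ∑ i ∈ Finset.Icc 1 d, trigamma ((ν - d - i) / 2) > 2 * d / (ν - d - 1) := by
  calc 2 * d / (ν - d - 1) = ∑ i ∈ Finset.Icc 1 d, 2 / (ν - d - 1) := by
        simp only [Finset.sum_const, Nat.card_Icc, add_tsub_cancel_right, nsmul_eq_mul]
        ring
    _ < ∑ i ∈ Finset.Icc 1 d, trigamma ((ν - d - i) / 2) := by
        refine Finset.sum_lt_sum_of_nonempty (Finset.nonempty_Icc.2 hd) fun i hi => ?_
        obtain ⟨hi1, hid⟩ := Finset.mem_Icc.1 hi
        have hi1' : (1 : ℝ) ≤ i := by exact_mod_cast hi1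
        have hid' : (i : ℝ) ≤ d := by exact_mod_cast hid
        have hpos : 0 < ν - d - i := by linarith
        calc 2 / (ν - d - 1) ≤ 2 / (ν - d - i) := by gcongr
          _ = 1 / ((ν - d - i) / 2) := (one_div_div _ _).symm
          _ < trigamma ((ν - d - i) / 2) := one_div_lt_trigamma (half_pos hpos)
end

section
/- Let d ≥ 1 be a natural number, let ν be a real number with ν > 2d, and let V be a symmetric positive definite d×d real matrix. Consider the (d² + 1) × (d² + 1) symmetric block matrix H, indexed by (Fin d × Fin d) ⊕ Unit, whose top-left d²×d² block is ((ν - d - 1)/2) · (V⁻¹ ⊗ V⁻¹), whose top-right column block is -(1/2) · vec(V⁻¹), whose bottom-left row block is -(1/2) · vec(V⁻¹)ᵀ, and whose bottom-right scalar block is (1/4) · ∑_{i=1}^{d} ψ₁((ν - d - i)/2). Then H is positive definite. -/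
open Matrix in
/-- The Schur complement criterion, with the product `A⁻¹ * B` given as a solution `Y` of
`A * Y = B`. -/
theorem Matrix.PosDef.fromBlocks_of_mul_eq {m n : Type*} [Fintype m] [DecidableEq m] [Fintype n]
    {A : Matrix m m ℝ} {B Y : Matrix m n ℝ} {D : Matrix n n ℝ} (hA : A.PosDef)
    (hY : A * Y = B) (hD : (D - Bᴴ * Y).PosDef) :
    (fromBlocks A B Bᴴ D).PosDef := by
  have := hA.isUnit.invertible
  have hS : A⁻¹ * B = Y := by rw [← hY, inv_mul_cancel_left_of_invertible]
  rw [← hS, ← Matrix.mul_assoc] at hD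
  refine posDef_iff_dotProduct_mulVec.mpr
    ⟨(IsHermitian.fromBlocks₁₁ _ _ hA.1).mpr hD.1, fun x hx => ?_⟩
  rw [dotProduct_mulVec, ← Sum.elim_comp_inl_inr x, schur_complement_eq₁₁ B D _ _ hA.1,
    ← dotProduct_mulVec, ← dotProduct_mulVec]
  by_cases hy : x ∘ Sum.inr = 0
  · have hz : x ∘ Sum.inl ≠ 0 := fun hz => hx <| by
      rw [← Sum.elim_comp_inl_inr x, hy, hz, Sum.elim_zero_zero]
    simpa [hy] using hA.dotProduct_mulVec_pos hz
  · exact add_pos_of_nonneg_of_pos (hA.posSemidef.dotProduct_mulVec_nonneg _)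
      (hD.dotProduct_mulVec_pos hy)

theorem lt_sum_trigamma {d : ℕ} (hd : 1 ≤ d) {ν : ℝ} (hν : 2 * d < ν) :
    2 * d / (ν - d - 1) < ∑ i ∈ Finset.Icc 1 d, trigamma ((ν - d - i) / 2) := by
  have : ∑ _i ∈ Finset.Icc 1 d, 2 / (ν - d - 1) <
      ∑ i ∈ Finset.Icc 1 d, trigamma ((ν - d - i) / 2) := by
    refine Finset.sum_lt_sum_of_nonempty (Finset.nonempty_Icc.mpr hd) fun i hi => ?_
    obtain ⟨h₁, h₂⟩ := Finset.mem_Icc.mp hi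
    have h₁ : (1 : ℝ) ≤ i := by exact_mod_cast h₁
    have h₂ : (i : ℝ) ≤ d := by exact_mod_cast h₂
    have hpos : 0 < ν - d - i := by linarith
    calc 2 / (ν - d - 1) ≤ 2 / (ν - d - i) := by gcongr
      _ = 1 / ((ν - d - i) / 2) := by rw [one_div_div]
      _ < _ := one_div_lt_trigamma (by positivity)
  convert this using 1
  simp
  ring

/-- **Lemma 2 (Hessian step).** The negative Hessian of the Kullback-Leibler
objective, the `(d²+1) × (d²+1)` block matrix with top-left block
`((ν-d-1)/2)·(V⁻¹ ⊗ V⁻¹)`, off-diagonal blocks `-(1/2)·vec(V⁻¹)` (and its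
transpose), and bottom-right scalar `(1/4)·∑_{i=1}^d ψ₁((ν-d-i)/2)`,
is positive definite. Here `vec(A)_{(i,j)} = A_{j,i}` and
`(A ⊗ B)_{(i,j),(k,l)} = A_{i,k} · B_{j,l}`. -/
theorem negHessian_posDef
    (d : ℕ) (hd : 1 ≤ d) (ν : ℝ) (hν : ν > 2 * d)
    (V : Matrix (Fin d) (Fin d) ℝ) (hV : V.PosDef) :
    (Matrix.fromBlocks
      (((ν - d - 1) / 2) •
        Matrix.of (fun p q : Fin d × Fin d => V⁻¹ p.1 q.1 * V⁻¹ p.2 q.2))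
      (Matrix.of (fun (p : Fin d × Fin d) (_ : Unit) => -(1 / 2) * V⁻¹ p.2 p.1))
      (Matrix.of (fun (_ : Unit) (q : Fin d × Fin d) => -(1 / 2) * V⁻¹ q.2 q.1))
      (Matrix.of (fun (_ _ : Unit) =>
        (1 / 4) * ∑ i ∈ Finset.Icc 1 d, trigamma ((ν - d - i) / 2)))).PosDef := by
  have hd' : (1 : ℝ) ≤ d := by exact_mod_cast hd
  have hc : 0 < (ν - d - 1) / 2 := by linarith
  have hdet : IsUnit V.det := V.isUnit_iff_isUnit_det.mp hV.isUnit
  have hsymm : V.IsSymm := by simpa using hV.isHermitian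
  have hsymm' : (V⁻¹).transpose = V⁻¹ := by rw [Matrix.transpose_nonsing_inv, hsymm.eq]
  have hmul := Matrix.kronecker_mulVec_vec V⁻¹ V (V⁻¹)
  rw [hsymm', Matrix.nonsing_inv_mul _ hdet, Matrix.one_mul] at hmul
  have hA : (((ν - d - 1) / 2) • Matrix.of (fun p q : Fin d × Fin d =>
      V⁻¹ p.1 q.1 * V⁻¹ p.2 q.2)).PosDef := (hV.inv.kronecker hV.inv).smul hc
  have hB : (Matrix.of fun (_ : Unit) (q : Fin d × Fin d) => -(1 / 2) * V⁻¹ q.2 q.1) =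
      (Matrix.of fun (p : Fin d × Fin d) (_ : Unit) => -(1 / 2) * V⁻¹ p.2 p.1).conjTranspose := by
    ext
    simp
  rw [hB]
  refine hA.fromBlocks_of_mul_eq
    (Y := Matrix.of fun p _ => -(1 / (ν - d - 1)) * V.vec p) ?_ ?_
  · ext p u
    have := congrFun hmul p
    simp only [Matrix.mulVec, dotProduct, Matrix.kroneckerMap_apply, Matrix.vec] at this
    simp only [Matrix.smul_apply, Matrix.mul_apply, Matrix.of_apply, Matrix.vec,
      smul_eq_mul, ← this, Finset.mul_sum]
    refine Finset.sum_congr rfl fun q _ => ?_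
    have : ν - d - 1 ≠ 0 := by linarith
    field_simp
  · have htr : ∑ p : Fin d × Fin d, V⁻¹ p.2 p.1 * V p.2 p.1 = d := by
      have : (V⁻¹ * V).trace = d := by simp [Matrix.nonsing_inv_mul _ hdet]
      rw [← this, Fintype.sum_prod_type]
      simp only [Matrix.trace, Matrix.diag, Matrix.mul_apply]
      refine Finset.sum_congr rfl fun i _ => Finset.sum_congr rfl fun j _ => ?_
      rw [← congrFun₂ hsymm' j i, Matrix.transpose_apply]
    have hlt := lt_sum_trigamma hd hν
    have key : ∑ p : Fin d × Fin d, -(1 / 2) * V⁻¹ p.2 p.1 * (-(1 / (ν - d - 1)) * V p.2 p.1) =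
        1 / 4 * (2 * d / (ν - d - 1)) := by
      rw [← htr, Finset.mul_sum, Finset.sum_div, Finset.mul_sum]
      refine Finset.sum_congr rfl fun q _ => ?_
      ring
    have hpos : 0 < 1 / 4 * ∑ i ∈ Finset.Icc 1 d, trigamma ((ν - d - i) / 2) -
        1 / 4 * (2 * d / (ν - d - 1)) := by linarith
    convert! (Matrix.PosDef.one (n := Unit) (R := ℝ)).smul hpos using 1
    ext
    simp only [Matrix.sub_apply, Matrix.mul_apply, Matrix.of_apply, Matrix.conjTranspose_apply,
      Matrix.vec, star_trivial, key, Matrix.smul_apply, Matrix.one_apply_eq, smul_eq_mul, mul_one]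
end

section
/- Let d ≥ 1 be a natural number, let c be a real number, and let E be a symmetric positive definite d×d real matrix. Define the set S = {(ν, V) : ν ∈ ℝ, ν > 2d, V a symmetric positive definite d×d real matrix} and the function f(ν, V) = ((ν - d - 1)/2)·(log det V - d·log 2) - (ν/2)·c - (1/2)·tr(V·E) - log Γ_d((ν - d - 1)/2). Then S is a convex subset of ℝ × (the real vector space of d×d symmetric matrices) and f is strictly concave on S. -/
/-- The multivariate gamma function
`Γ_d(a) = π^{d(d-1)/4} · ∏_{i=1}^{d} Γ(a - (i-1)/2)`. -/
noncomputable def mvGamma (d : ℕ) (a : ℝ) : ℝ :=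
  Real.pi ^ ((d : ℝ) * ((d : ℝ) - 1) / 4) *
    ∏ i ∈ Finset.Icc 1 d, Real.Gamma (a - ((i : ℝ) - 1) / 2)

open Matrix in
/-- If all eigenvalues of a Hermitian matrix are `1`, the matrix is the identity. -/
theorem Matrix.IsHermitian.eq_one_of_eigenvalues_eq_one {n : Type*} [Fintype n] [DecidableEq n]
    {A : Matrix n n ℝ} (hA : A.IsHermitian) (h : ∀ i, hA.eigenvalues i = 1) : A = 1 := by
  have hev : (RCLike.ofReal ∘ hA.eigenvalues : n → ℝ) = 1 := by
    ext i
    simp [h i]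
  rw [hA.spectral_theorem, hev, Pi.one_def, diagonal_one, map_one]

theorem Matrix.PosDef.log_det_lt_trace_sub_card {n : Type*} [Fintype n] [DecidableEq n]
    {A : Matrix n n ℝ} (hA : A.PosDef) (h : A ≠ 1) :
    Real.log A.det < A.trace - Fintype.card n := by
  have hpos := hA.eigenvalues_pos
  obtain ⟨j, hj⟩ : ∃ j, hA.1.eigenvalues j ≠ 1 := by
    by_contra! hall
    exact h (hA.1.eq_one_of_eigenvalues_eq_one hall)
  rw [hA.1.det_eq_prod_eigenvalues, hA.1.trace_eq_sum_eigenvalues]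
  simp only [RCLike.ofReal_real_eq_id, id_eq]
  rw [Real.log_prod fun i _ => (hpos i).ne']
  calc ∑ i, Real.log (hA.1.eigenvalues i) < ∑ i, (hA.1.eigenvalues i - 1) :=
        Finset.sum_lt_sum (fun i _ => Real.log_le_sub_one_of_pos (hpos i))
          ⟨j, Finset.mem_univ j, Real.log_lt_sub_one_of_pos (hpos j) hj⟩
    _ = _ := by simp

open scoped MatrixOrder in
/-- The graph of `log det` lies strictly below its tangent plane at `M`, away from `M`. -/
theorem Matrix.PosDef.log_det_lt_tangent {n : Type*} [Fintype n] [DecidableEq n]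
    {B M : Matrix n n ℝ} (hB : B.PosDef) (hM : M.PosDef) (h : B ≠ M) :
    Real.log B.det < Real.log M.det + (M⁻¹ * B).trace - Fintype.card n := by
  obtain ⟨Y, hY⟩ := CStarAlgebra.nonneg_iff_eq_star_mul_self.mp hM.inv.posSemidef.nonneg
  have hdet : M⁻¹.det = Y.det * Y.det := by
    rw [hY, Matrix.det_mul, Matrix.star_eq_conjTranspose, Matrix.det_conjTranspose, star_trivial]
  have hYdet : Y.det ≠ 0 := by
    intro h0
    exact hM.inv.det_pos.ne' (by rw [hdet, h0, mul_zero])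
  have hYu : IsUnit Y := (Matrix.isUnit_iff_isUnit_det Y).mpr hYdet.isUnit
  have hN : (Y * B * star Y).PosDef := (Matrix.IsUnit.posDef_star_right_conjugate_iff hYu).mpr hB
  have hN1 : Y * B * star Y ≠ 1 := by
    intro h1
    have h2 : star Y * Y * B = 1 := by
      have h3 := mul_eq_one_comm.mp h1
      rw [mul_assoc]
      exact h3
    rw [← hY] at h2
    apply h
    rw [← Matrix.mul_nonsing_inv_cancel_left M B ((Matrix.isUnit_iff_isUnit_det M).mp hM.isUnit),
      h2, mul_one]
  have key := hN.log_det_lt_trace_sub_card hN1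
  have htr : (Y * B * star Y).trace = (M⁻¹ * B).trace := by
    rw [hY, Matrix.trace_mul_comm, mul_assoc]
  have hdetN : (Y * B * star Y).det = B.det * M.det⁻¹ := by
    have : M.det⁻¹ = Y.det * Y.det := by
      rw [← hdet, Matrix.det_nonsing_inv, Ring.inverse_eq_inv']
    rw [this, Matrix.det_mul, Matrix.det_mul, Matrix.star_eq_conjTranspose,
      Matrix.det_conjTranspose, star_trivial]
    ring
  rw [htr, hdetN, Real.log_mul hB.det_pos.ne' (inv_pos.mpr hM.det_pos).ne', Real.log_inv] at key
  linarith

/-- The tangent inequality for `log det` at `r • M`. -/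
theorem Matrix.PosDef.log_det_lt_tangent_smul {n : Type*} [Fintype n] [DecidableEq n]
    {B M : Matrix n n ℝ} (hB : B.PosDef) (hM : M.PosDef) {r : ℝ} (hr : 0 < r) (h : B ≠ r • M) :
    Real.log B.det < Fintype.card n * Real.log r + Real.log M.det + r⁻¹ * (M⁻¹ * B).trace
      - Fintype.card n := by
  have key := hB.log_det_lt_tangent (hM.smul hr) h
  have hinv : (r • M)⁻¹ = r⁻¹ • M⁻¹ := by
    apply Matrix.inv_eq_right_inv
    rw [smul_mul_smul_comm, mul_inv_cancel₀ hr.ne', one_smul,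
      Matrix.mul_nonsing_inv M ((Matrix.isUnit_iff_isUnit_det M).mp hM.isUnit)]
  rw [hinv, Matrix.det_smul, Real.log_mul (pow_pos hr _).ne' hM.det_pos.ne', Real.log_pow,
    Matrix.smul_mul, Matrix.trace_smul, smul_eq_mul] at key
  exact key

theorem Matrix.PosDef.log_det_le_tangent_smul {n : Type*} [Fintype n] [DecidableEq n]
    {B M : Matrix n n ℝ} (hB : B.PosDef) (hM : M.PosDef) {r : ℝ} (hr : 0 < r) :
    Real.log B.det ≤ Fintype.card n * Real.log r + Real.log M.det + r⁻¹ * (M⁻¹ * B).trace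
      - Fintype.card n := by
  by_cases h : B = r • M
  · subst h
    rw [Matrix.mul_smul, Matrix.nonsing_inv_mul M ((Matrix.isUnit_iff_isUnit_det M).mp hM.isUnit),
      Matrix.trace_smul, Matrix.trace_one, smul_eq_mul, inv_mul_cancel_left₀ hr.ne',
      Matrix.det_smul, Real.log_mul (pow_pos hr _).ne' hM.det_pos.ne', Real.log_pow]
    linarith
  · exact (hB.log_det_lt_tangent_smul hM hr h).le

open Set Filter Topology

theorem strictConvexOn_logGamma_increment {k : ℝ} (hk : 0 ≤ k) :
    StrictConvexOn ℝ (Ioi 0) (fun x : ℝ =>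
      (x + k + 1) * Real.log (x + k + 1) - (x + k) * Real.log (x + k) - Real.log x) := by
  have hd1 : ∀ x ∈ Ioi (0 : ℝ), HasDerivAt (fun x : ℝ =>
      (x + k + 1) * Real.log (x + k + 1) - (x + k) * Real.log (x + k) - Real.log x)
      (Real.log (x + k + 1) - Real.log (x + k) - x⁻¹) x := by
    intro x hx
    have hx : 0 < x := hx
    have h1 := (Real.hasDerivAt_mul_log (x := x + k + 1) (by positivity)).comp x
      (((hasDerivAt_id x).add_const k).add_const 1)
    have h2 := (Real.hasDerivAt_mul_log (x := x + k) (by positivity)).comp x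
      ((hasDerivAt_id x).add_const k)
    exact ((h1.sub h2).sub (Real.hasDerivAt_log hx.ne')).congr_deriv (by ring)
  have hd2 : ∀ x ∈ Ioi (0 : ℝ), HasDerivAt (fun x : ℝ =>
      Real.log (x + k + 1) - Real.log (x + k) - x⁻¹)
      ((x + k + 1)⁻¹ - (x + k)⁻¹ + (x ^ 2)⁻¹) x := by
    intro x hx
    have hx : 0 < x := hx
    have h1 := (Real.hasDerivAt_log (x := x + k + 1) (by positivity)).comp x
      (((hasDerivAt_id x).add_const k).add_const 1)
    have h2 := (Real.hasDerivAt_log (x := x + k) (by positivity)).comp x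
      ((hasDerivAt_id x).add_const k)
    exact ((h1.sub h2).sub (hasDerivAt_inv hx.ne')).congr_deriv (by ring)
  refine strictConvexOn_of_deriv2_pos (convex_Ioi 0)
    (fun x hx => (hd1 x hx).continuousAt.continuousWithinAt) fun x hx => ?_
  rw [interior_Ioi] at hx
  have heq : deriv (fun x : ℝ =>
      (x + k + 1) * Real.log (x + k + 1) - (x + k) * Real.log (x + k) - Real.log x) =ᶠ[𝓝 x]
      fun x => Real.log (x + k + 1) - Real.log (x + k) - x⁻¹ := by
    filter_upwards [Ioi_mem_nhds hx] with y hy using (hd1 y hy).deriv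
  have hx : 0 < x := hx
  rw [Function.iterate_succ_apply, Function.iterate_one, heq.deriv_eq, (hd2 x hx).deriv]
  have : (x + k + 1)⁻¹ - (x + k)⁻¹ + (x ^ 2)⁻¹ =
      (2 * x * k + k ^ 2 + x + k) / ((x + k + 1) * (x + k) * x ^ 2) := by
    field_simp
    ring
  rw [this]
  positivity

/-- The Jensen gap of `x log x` is at most the variance divided by the mean. -/
theorem mul_log_jensen_gap_le {x y a b : ℝ} (hx : 0 < x) (hy : 0 < y) (ha : 0 < a) (hb : 0 < b)
    (hab : a + b = 1) :
    a * (x * Real.log x) + b * (y * Real.log y) - (a * x + b * y) * Real.log (a * x + b * y) ≤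
      a * b * (x - y) ^ 2 / (a * x + b * y) := by
  have hz : 0 < a * x + b * y := by positivity
  have key : ∀ u : ℝ, 0 < u → Real.log u - Real.log (a * x + b * y) ≤ u / (a * x + b * y) - 1 := by
    intro u hu
    rw [← Real.log_div hu.ne' hz.ne']
    exact Real.log_le_sub_one_of_pos (by positivity)
  have h1 := mul_le_mul_of_nonneg_left (key x hx) (mul_pos ha hx).le
  have h2 := mul_le_mul_of_nonneg_left (key y hy) (mul_pos hb hy).le
  have h3 : a * x * (x / (a * x + b * y) - 1) + b * y * (y / (a * x + b * y) - 1) =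
      a * b * (x - y) ^ 2 / (a * x + b * y) := by
    obtain rfl : b = 1 - a := by linarith
    field_simp
    ring
  linarith

/-- Strengthening of the log-convexity of the Gamma function. -/
theorem strictConvexOn_logGamma_sub_mul_log {k : ℝ} (hk : 0 ≤ k) :
    StrictConvexOn ℝ (Ioi 0) (fun x : ℝ =>
      Real.log (Real.Gamma x) - (x + k) * Real.log (x + k)) := by
  set g : ℝ → ℝ := fun x => Real.log (Real.Gamma x) - (x + k) * Real.log (x + k) with hg
  set φ : ℝ → ℝ := fun x =>
      (x + k + 1) * Real.log (x + k + 1) - (x + k) * Real.log (x + k) - Real.log x with hφ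
  have hstep : ∀ x : ℝ, 0 < x → g x = φ x + g (x + 1) := by
    intro x hx
    simp only [hg, hφ]
    rw [Real.Gamma_add_one hx.ne', Real.log_mul hx.ne' (Real.Gamma_pos_of_pos hx).ne']
    ring_nf
  have hφc : StrictConvexOn ℝ (Ioi 0) φ := strictConvexOn_logGamma_increment hk
  refine ⟨convex_Ioi 0, fun x hx y hy hxy a b ha hb hab => ?_⟩
  have hx : 0 < x := hx
  have hy : 0 < y := hy
  simp only [smul_eq_mul]
  have hz : 0 < a * x + b * y := by positivity
  have hφ0 : φ (a * x + b * y) < a * φ x + b * φ y := hφc.2 hx hy hxy ha hb hab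
  have hmono : ∀ n : ℕ, a * g (x + 1) + b * g (y + 1) - g (a * x + b * y + 1) ≥
      a * g (x + 1 + n) + b * g (y + 1 + n) - g (a * x + b * y + 1 + n) := by
    intro n
    induction n with
    | zero => simp
    | succ n ih =>
      have e1 := hstep (x + 1 + n) (by positivity)
      have e2 := hstep (y + 1 + n) (by positivity)
      have e3 := hstep (a * x + b * y + 1 + n) (by positivity)
      have hc : φ (a * (x + 1 + n) + b * (y + 1 + n)) ≤ a * φ (x + 1 + n) + b * φ (y + 1 + n) :=
        hφc.convexOn.2 (show 0 < x + 1 + (n : ℝ) by positivity)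
          (show 0 < y + 1 + (n : ℝ) by positivity) ha.le hb.le hab
      have e4 : a * (x + 1 + n) + b * (y + 1 + n) = a * x + b * y + 1 + n := by
        linear_combination (1 + (n : ℝ)) * hab
      rw [e4] at hc
      push_cast
      simp only [← add_assoc]
      rw [e1, e2, e3] at ih
      linarith
  have hbound : ∀ n : ℕ, -(a * b * (x - y) ^ 2 / (a * x + b * y + 1 + k + n)) ≤
      a * g (x + 1) + b * g (y + 1) - g (a * x + b * y + 1) := by
    intro n
    refine le_trans ?_ (hmono n)
    have e4 : a * (x + 1 + n) + b * (y + 1 + n) = a * x + b * y + 1 + n := by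
      linear_combination (1 + (n : ℝ)) * hab
    have e5 : a * (x + 1 + n + k) + b * (y + 1 + n + k) = a * x + b * y + 1 + n + k := by
      linear_combination (1 + (n : ℝ) + k) * hab
    have hΓ : Real.log (Real.Gamma (a * (x + 1 + n) + b * (y + 1 + n))) ≤
        a * Real.log (Real.Gamma (x + 1 + n)) + b * Real.log (Real.Gamma (y + 1 + n)) :=
      Real.convexOn_log_Gamma.2 (show 0 < x + 1 + (n : ℝ) by positivity)
          (show 0 < y + 1 + (n : ℝ) by positivity) ha.le hb.le hab
    have hgap := mul_log_jensen_gap_le (x := x + 1 + n + k) (y := y + 1 + n + k)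
      (by positivity) (by positivity) ha hb hab
    rw [e5, show x + 1 + n + k - (y + 1 + n + k) = x - y by ring] at hgap
    rw [e4] at hΓ
    rw [show a * x + b * y + 1 + k + n = a * x + b * y + 1 + n + k by ring]
    simp only [hg]
    linarith
  have hlim : Tendsto (fun n : ℕ => -(a * b * (x - y) ^ 2 / (a * x + b * y + 1 + k + n)))
      atTop (𝓝 0) := by
    rw [← neg_zero]
    exact ((tendsto_atTop_add_const_left atTop _ tendsto_natCast_atTop_atTop).const_div_atTop _).neg
  have hnn : 0 ≤ a * g (x + 1) + b * g (y + 1) - g (a * x + b * y + 1) :=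
    le_of_tendsto' hlim hbound
  rw [hstep x hx, hstep y hy, hstep _ hz]
  linarith

theorem Matrix.PosDef.convexComb {n : Type*} [Fintype n] {A B : Matrix n n ℝ} (hA : A.PosDef)
    (hB : B.PosDef) {a b : ℝ} (ha : 0 < a) (hb : 0 < b) : (a • A + b • B).PosDef :=
  (hA.smul ha).add (hB.smul hb)

theorem Matrix.trace_inv_mul_convexComb {n : Type*} [Fintype n] [DecidableEq n]
    {A B : Matrix n n ℝ} {a b : ℝ} (h : IsUnit (a • A + b • B)) :
    a * ((a • A + b • B)⁻¹ * A).trace + b * ((a • A + b • B)⁻¹ * B).trace = Fintype.card n := by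
  have key := congrArg Matrix.trace
    (Matrix.nonsing_inv_mul _ ((Matrix.isUnit_iff_isUnit_det _).mp h))
  rw [Matrix.mul_add, Matrix.trace_add, Matrix.mul_smul, Matrix.mul_smul, Matrix.trace_smul,
    Matrix.trace_smul, Matrix.trace_one] at key
  exact key

theorem convex_Ioi_posDef (n : Type*) [Fintype n] (r : ℝ) :
    Convex ℝ {p : ℝ × Matrix n n ℝ | r < p.1 ∧ p.2.PosDef} :=
  convex_iff_forall_pos.mpr fun _ hp _ hq _ _ ha hb hab =>
    ⟨convex_Ioi r hp.1 hq.1 ha.le hb.le hab, hp.2.convexComb hq.2 ha hb⟩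

theorem strictConcaveOn_log_det (n : Type*) [Fintype n] [DecidableEq n] :
    StrictConcaveOn ℝ {A : Matrix n n ℝ | A.PosDef} (fun A => Real.log A.det) := by
  refine ⟨convex_iff_forall_pos.mpr fun A hA B hB a b ha hb _ => hA.convexComb hB ha hb,
    fun A hA B hB hAB a b ha hb hab => ?_⟩
  have hA : A.PosDef := hA
  have hB : B.PosDef := hB
  have hM := hA.convexComb hB ha hb
  set M := a • A + b • B with hMdef
  have hAM : A ≠ M := by
    intro h
    apply hAB
    have h1 : b • (A - B) = 0 := by
      have h2 : a • A + b • A = a • A + b • B := by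
        rw [← add_smul, hab, one_smul, ← hMdef, ← h]
      rw [smul_sub, sub_eq_zero]
      exact add_left_cancel h2
    exact sub_eq_zero.mp ((smul_eq_zero.mp h1).resolve_left hb.ne')
  have h1 := mul_lt_mul_of_pos_left (hA.log_det_lt_tangent hM hAM) ha
  have h2 := mul_le_mul_of_nonneg_left (hB.log_det_le_tangent_smul hM one_pos) hb.le
  have htr : a * (M⁻¹ * A).trace + b * (M⁻¹ * B).trace = Fintype.card n :=
    Matrix.trace_inv_mul_convexComb hM.isUnit
  rw [Real.log_one, inv_one] at h2
  simp only [smul_eq_mul]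
  linear_combination h1 + h2 + htr + (Real.log M.det - Fintype.card n) * hab

/-- The perspective of `log det` is jointly concave. -/
theorem concaveOn_perspective_log_det (n : Type*) [Fintype n] [DecidableEq n] :
    ConcaveOn ℝ {p : ℝ × Matrix n n ℝ | 0 < p.1 ∧ p.2.PosDef}
      (fun p => p.1 * Real.log p.2.det - Fintype.card n * (p.1 * Real.log p.1)) := by
  refine concaveOn_iff_forall_pos.mpr ⟨convex_Ioi_posDef n 0, ?_⟩
  rintro ⟨x, A⟩ ⟨hx : 0 < x, hA : A.PosDef⟩ ⟨y, B⟩ ⟨hy : 0 < y, hB : B.PosDef⟩ a b ha hb hab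
  have hM := hA.convexComb hB ha hb
  simp only [Prod.smul_mk, Prod.mk_add_mk, smul_eq_mul]
  set M := a • A + b • B with hMdef
  have hz : 0 < a * x + b * y := by positivity
  set z := a * x + b * y with hzdef
  have h1 := mul_le_mul_of_nonneg_left (hA.log_det_le_tangent_smul hM (div_pos hx hz))
    (mul_pos ha hx).le
  have h2 := mul_le_mul_of_nonneg_left (hB.log_det_le_tangent_smul hM (div_pos hy hz))
    (mul_pos hb hy).le
  have htr : a * (M⁻¹ * A).trace + b * (M⁻¹ * B).trace = Fintype.card n :=
    Matrix.trace_inv_mul_convexComb hM.isUnit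
  rw [Real.log_div hx.ne' hz.ne', inv_div] at h1
  rw [Real.log_div hy.ne' hz.ne', inv_div] at h2
  have e1 : a * x * (z / x * (M⁻¹ * A).trace) = z * (a * (M⁻¹ * A).trace) := by field_simp
  have e2 : b * y * (z / y * (M⁻¹ * B).trace) = z * (b * (M⁻¹ * B).trace) := by field_simp
  linear_combination h1 + h2 + e1 + e2 + z * htr -
    (Real.log M.det - Fintype.card n - Fintype.card n * Real.log z) * hzdef

theorem strictConvexOn_logGamma_sub_const {k : ℝ} (hk : 0 ≤ k) :
    StrictConvexOn ℝ (Ioi k) (fun x : ℝ => Real.log (Real.Gamma (x - k)) - x * Real.log x) := by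
  refine ⟨convex_Ioi k, fun x hx y hy hxy a b ha hb hab => ?_⟩
  have key := (strictConvexOn_logGamma_sub_mul_log hk).2 (mem_Ioi.mpr (sub_pos.mpr hx))
    (mem_Ioi.mpr (sub_pos.mpr hy)) (fun h => hxy (sub_left_injective h)) ha hb hab
  have e : a • (x - k) + b • (y - k) = a • x + b • y - k := by
    simp only [smul_eq_mul]
    linear_combination (-k) * hab
  simpa only [e, sub_add_cancel] using key

/-- Concavity in the shape parameter `(ν - d - 1) / 2` and the scale matrix. -/
theorem strictConcaveOn_mul_log_det_sub_sum_logGamma (d : ℕ) (hd : 1 ≤ d) :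
    StrictConcaveOn ℝ {p : ℝ × Matrix (Fin d) (Fin d) ℝ | ((d : ℝ) - 1) / 2 < p.1 ∧ p.2.PosDef}
      (fun p => p.1 * Real.log p.2.det -
        ∑ i ∈ Finset.Icc 1 d, Real.log (Real.Gamma (p.1 - ((i : ℝ) - 1) / 2))) := by
  refine ⟨convex_Ioi_posDef (Fin d) _, ?_⟩
  have hd' : (1 : ℝ) ≤ d := by exact_mod_cast hd
  rintro ⟨x, A⟩ ⟨hx : _ < x, hA : A.PosDef⟩ ⟨y, B⟩ ⟨hy : _ < y, hB : B.PosDef⟩ hne a b ha hb hab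
  have hx0 : 0 < x := by linarith
  have hy0 : 0 < y := by linarith
  rcases eq_or_ne x y with rfl | hxy
  · have hAB : A ≠ B := fun h => hne (by rw [h])
    have key := mul_lt_mul_of_pos_left ((strictConcaveOn_log_det (Fin d)).2 hA hB hAB ha hb hab) hx0
    have hxx : a * x + b * x = x := by rw [← add_mul, hab, one_mul]
    simp only [Prod.smul_mk, Prod.mk_add_mk, smul_eq_mul, hxx] at key ⊢
    linear_combination key - (∑ i ∈ Finset.Icc 1 d,
      Real.log (Real.Gamma (x - ((i : ℝ) - 1) / 2))) * hab
  · have key := (concaveOn_perspective_log_det (Fin d)).2 (x := (x, A)) ⟨hx0, hA⟩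
      (y := (y, B)) ⟨hy0, hB⟩ ha.le hb.le hab
    have hsum := Finset.sum_lt_sum_of_nonempty (Finset.nonempty_Icc.mpr hd) fun i hi => by
      have hi1 : (1 : ℝ) ≤ i := by exact_mod_cast (Finset.mem_Icc.mp hi).1
      have hid : (i : ℝ) ≤ d := by exact_mod_cast (Finset.mem_Icc.mp hi).2
      exact (strictConvexOn_logGamma_sub_const (k := ((i : ℝ) - 1) / 2) (by linarith)).2
        (mem_Ioi.mpr (by linarith)) (mem_Ioi.mpr (by linarith)) hxy ha hb hab
    simp only [Prod.smul_mk, Prod.mk_add_mk, smul_eq_mul, Fintype.card_fin,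
      Finset.sum_add_distrib, ← Finset.mul_sum, Finset.sum_sub_distrib, Finset.sum_const,
      Nat.card_Icc, add_tsub_cancel_right, nsmul_eq_mul] at key hsum ⊢
    linear_combination key + hsum

theorem log_mvGamma {d : ℕ} {x : ℝ} (hx : ((d : ℝ) - 1) / 2 < x) :
    Real.log (mvGamma d x) = (d : ℝ) * ((d : ℝ) - 1) / 4 * Real.log Real.pi +
      ∑ i ∈ Finset.Icc 1 d, Real.log (Real.Gamma (x - ((i : ℝ) - 1) / 2)) := by
  have hpos : ∀ i ∈ Finset.Icc 1 d, Real.Gamma (x - ((i : ℝ) - 1) / 2) ≠ 0 := fun i hi => by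
    have hid : (i : ℝ) ≤ d := by exact_mod_cast (Finset.mem_Icc.mp hi).2
    exact (Real.Gamma_pos_of_pos (by linarith)).ne'
  rw [mvGamma,
    Real.log_mul (Real.rpow_pos_of_pos Real.pi_pos _).ne' (Finset.prod_ne_zero_iff.mpr hpos),
    Real.log_rpow Real.pi_pos, Real.log_prod hpos]


/-- **Lemma 2 (concavity).** The set
`S = {(ν, V) : ν > 2d, V symmetric positive definite}` is convex and the
Kullback-Leibler objective
`f(ν,V) = ((ν-d-1)/2)(log det V - d log 2) - (ν/2)c - (1/2)tr(V·E) - log Γ_d((ν-d-1)/2)`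
is strictly concave on it. -/
theorem kl_objective_strictConcaveOn
    (d : ℕ) (hd : 1 ≤ d) (c : ℝ)
    (E : Matrix (Fin d) (Fin d) ℝ) (hE : E.PosDef) :
    Convex ℝ {p : ℝ × Matrix (Fin d) (Fin d) ℝ | 2 * d < p.1 ∧ p.2.PosDef} ∧
      StrictConcaveOn ℝ {p : ℝ × Matrix (Fin d) (Fin d) ℝ | 2 * d < p.1 ∧ p.2.PosDef}
        (fun p : ℝ × Matrix (Fin d) (Fin d) ℝ =>
          ((p.1 - d - 1) / 2) * (Real.log p.2.det - d * Real.log 2) -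
            (p.1 / 2) * c - (1 / 2) * (p.2 * E).trace -
            Real.log (mvGamma d ((p.1 - d - 1) / 2))) := by
  have hconv := convex_Ioi_posDef (Fin d) (2 * d)
  refine ⟨hconv, hconv, ?_⟩
  rintro ⟨x, A⟩ ⟨hx : _ < x, hA : A.PosDef⟩ ⟨y, B⟩ ⟨hy : _ < y, hB : B.PosDef⟩ hne a b ha hb hab
  have hd' : (1 : ℝ) ≤ d := by exact_mod_cast hd
  have shape : ∀ {u : ℝ}, 2 * d < u → ((d : ℝ) - 1) / 2 < (u - d - 1) / 2 := fun h => by linarith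
  have hz : 2 * d < a * x + b * y := convex_Ioi (2 * d : ℝ) hx hy ha.le hb.le hab
  have key := (strictConcaveOn_mul_log_det_sub_sum_logGamma d hd).2
    (x := ((x - d - 1) / 2, A)) ⟨shape hx, hA⟩ (y := ((y - d - 1) / 2, B)) ⟨shape hy, hB⟩
    (fun h => hne (by
      rw [Prod.mk.injEq] at h ⊢
      exact ⟨by linarith [h.1], h.2⟩)) ha hb hab
  have hcomb : a * ((x - d - 1) / 2) + b * ((y - d - 1) / 2) = (a * x + b * y - d - 1) / 2 := by
    linear_combination (-(d + 1 : ℝ) / 2) * hab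
  simp only [Prod.smul_mk, Prod.mk_add_mk, smul_eq_mul, hcomb] at key ⊢
  rw [log_mvGamma (shape hx), log_mvGamma (shape hy), log_mvGamma (shape hz), add_mul,
    Matrix.trace_add, Matrix.smul_mul, Matrix.smul_mul, Matrix.trace_smul, Matrix.trace_smul,
    smul_eq_mul, smul_eq_mul]
  linear_combination key + (d * Real.log 2 * ((d + 1) / 2 : ℝ) -
    (d : ℝ) * ((d : ℝ) - 1) / 4 * Real.log Real.pi) * hab
end

section
/- Let d ≥ 1 be a natural number, let V be a symmetric positive definite d×d real matrix, let Q be a symmetric positive semidefinite d×d real matrix, and let ν be a real number with ν > 2d + 2. Define V̄ = V·(I + Q·V)⁻¹, v = 2d + 2 + (ν - 2d - 2)·(det(I + Q·V))^{-1/d}, and H = (det(I + Q·V))^{1/d}·(I + Q·V)⁻¹. Then: (i) det(I + Q·V) ≥ 1 (in particular I + Q·V is invertible); (ii) det H = 1; and (iii) (1/(v - 2d - 2))·V̄ = (1/(ν - 2d - 2))·V·H. -/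
namespace Matrix

variable {n : Type*} [Fintype n] [DecidableEq n]

/-- If `A` is Hermitian, then `det (1 + A)` is the product of `1 + λ` over the eigenvalues `λ`. -/
theorem IsHermitian.det_one_add {A : Matrix n n ℝ} (hA : A.IsHermitian) :
    (1 + A).det = ∏ i, (1 + hA.eigenvalues i) := by
  have h : (-1 - A).det = ∏ i, (-1 - hA.eigenvalues i) := by
    have := congrArg (Polynomial.eval (-1)) hA.charpoly_eq
    rw [eval_charpoly, Polynomial.eval_prod, map_neg, map_one] at this
    simpa using this
  rw [show 1 + A = -(-1 - A) by abel, det_neg, h, ← Finset.card_univ, ← Finset.prod_const,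
    ← Finset.prod_mul_distrib]
  exact Finset.prod_congr rfl fun i _ => by ring

theorem PosSemidef.one_le_det_one_add_s13 {A : Matrix n n ℝ} (hA : A.PosSemidef) :
    1 ≤ (1 + A).det := by
  rw [hA.isHermitian.det_one_add]
  exact Finset.one_le_prod fun i _ => le_add_of_nonneg_right (hA.eigenvalues_nonneg i)

open scoped MatrixOrder in
theorem PosSemidef.one_le_det_one_add_mul {A B : Matrix n n ℝ} (hA : A.PosSemidef)
    (hB : B.PosSemidef) : 1 ≤ (1 + A * B).det := by
  obtain ⟨C, rfl⟩ := CStarAlgebra.nonneg_iff_eq_star_mul_self.mp hB.nonneg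
  rw [star_eq_conjTranspose, ← Matrix.mul_assoc, det_one_add_mul_comm, ← Matrix.mul_assoc]
  exact (hA.mul_mul_conjTranspose_same C).one_le_det_one_add_s13

end Matrix

/-- **Setting (47) and Lemma 9 (algebraic part).** With `V̄ = V(I + QV)⁻¹`,
`v = 2d + 2 + (ν - 2d - 2)·det(I + QV)^{-1/d}` and
`H = det(I + QV)^{1/d}·(I + QV)⁻¹`: (i) `det(I + QV) ≥ 1` (in particular
`I + QV` is invertible), (ii) `det H = 1`, and
(iii) `V̄/(v - 2d - 2) = (V/(ν - 2d - 2))·H`. -/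
theorem volume_preserving_dof_setting
    (d : ℕ) (hd : 1 ≤ d)
    (V Q : Matrix (Fin d) (Fin d) ℝ) (hV : V.PosDef) (hQ : Q.PosSemidef)
    (ν : ℝ) (hν : ν > 2 * d + 2)
    (Vbar : Matrix (Fin d) (Fin d) ℝ) (hVbar : Vbar = V * (1 + Q * V)⁻¹)
    (v : ℝ) (hv : v = 2 * d + 2 + (ν - 2 * d - 2) * ((1 + Q * V).det) ^ (-(1 : ℝ) / d))
    (H : Matrix (Fin d) (Fin d) ℝ)
    (hH : H = ((1 + Q * V).det) ^ ((1 : ℝ) / d) • (1 + Q * V)⁻¹) :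
    (1 ≤ (1 + Q * V).det ∧ IsUnit (1 + Q * V)) ∧
      H.det = 1 ∧
      (1 / (v - 2 * d - 2)) • Vbar = (1 / (ν - 2 * d - 2)) • (V * H) := by
  have h_one : 1 ≤ (1 + Q * V).det := hQ.one_le_det_one_add_mul hV.posSemidef
  have h_pos : 0 < (1 + Q * V).det := by linarith
  have h_dim : (d : ℝ) ≠ 0 := by exact_mod_cast Nat.one_le_iff_ne_zero.mp hd
  refine ⟨⟨h_one, (Matrix.isUnit_iff_isUnit_det _).mpr h_pos.ne'.isUnit⟩, ?_, ?_⟩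
  · rw [hH, Matrix.det_smul, Fintype.card_fin, Matrix.det_nonsing_inv, Ring.inverse_eq_inv',
      ← Real.rpow_mul_natCast h_pos.le, one_div_mul_cancel h_dim, Real.rpow_one,
      mul_inv_cancel₀ h_pos.ne']
  · rw [hVbar, hH, Matrix.mul_smul, smul_smul]
    congr 1
    rw [hv, neg_div, Real.rpow_neg h_pos.le]
    have h_scale : (1 + Q * V).det ^ ((1 : ℝ) / d) ≠ 0 := (Real.rpow_pos_of_pos h_pos _).ne'
    have h_dof : ν - 2 * d - 2 ≠ 0 := by linarith
    rw [show ∀ x : ℝ, 2 * d + 2 + x - 2 * d - 2 = x from fun x => by ring]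
    field_simp
end

section
/- Let d ≥ 1 be a natural number, let (α, μ) be a probability space, let M : α → Matrix (Fin d) (Fin d) ℝ be measurable, let V be a symmetric positive definite d×d real matrix, let Q be a symmetric positive semidefinite d×d real matrix, and let ν be a real number with ν > 2d + 2. Define V̄ = V·(I + Q·V)⁻¹, v = 2d + 2 + (ν - 2d - 2)·(det(I + Q·V))^{-1/d}, and H = (det(I + Q·V))^{1/d}·(I + Q·V)⁻¹, and assume x ↦ M(x)·V̄·M(x)ᵀ is (entrywise) integrable with respect to μ. Then (1/(v - 2d - 2)) · ∫ M(x)·V̄·M(x)ᵀ dμ(x) = ∫ M(x)·((1/(ν - 2d - 2))·V)·H·M(x)ᵀ dμ(x), and in particular the determinants of the two sides are equal. -/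
open MeasureTheory Matrix

open scoped MatrixOrder Matrix.Norms.L2Operator in
/-- The determinant of `1 + Q * V` is nonnegative for positive semidefinite `Q` and `V`. -/
theorem det_one_add_mul_nonneg {n : Type*} [Fintype n] [DecidableEq n]
    {Q V : Matrix n n ℝ} (hQ : Q.PosSemidef) (hV : V.PosSemidef) :
    0 ≤ (1 + Q * V).det := by
  obtain ⟨B, rfl⟩ := CStarAlgebra.nonneg_iff_eq_star_mul_self.mp hQ.nonneg
  rw [Matrix.mul_assoc, Matrix.det_one_add_mul_comm]
  exact (Matrix.PosSemidef.one.add (hV.mul_mul_conjTranspose_same B)).det_nonneg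

/-- **Lemma 9.** With the state-transition degrees of freedom
`v = 2d + 2 + (ν - 2d - 2)·det(I + QV)^{-1/d}`, `V̄ = V(I + QV)⁻¹`, and
`H = det(I + QV)^{1/d}·(I + QV)⁻¹`, the expected predicted extent
`(1/(v - 2d - 2))·∫ M(x) V̄ M(x)ᵀ dμ` equals
`∫ M(x)·(V/(ν - 2d - 2))·H·M(x)ᵀ dμ`; in particular both have the same
determinant (volume). Integrals of matrix-valued maps are entrywise. -/
theorem expected_extent_volume_preserved
    (d : ℕ) (hd : 1 ≤ d) {α : Type*} [MeasurableSpace α]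
    (μ : Measure α) [IsProbabilityMeasure μ]
    (M : α → Matrix (Fin d) (Fin d) ℝ) (hM : Measurable M)
    (V Q : Matrix (Fin d) (Fin d) ℝ) (hV : V.PosDef) (hQ : Q.PosSemidef)
    (ν : ℝ) (hν : ν > 2 * d + 2)
    (Vbar : Matrix (Fin d) (Fin d) ℝ) (hVbar : Vbar = V * (1 + Q * V)⁻¹)
    (v : ℝ) (hv : v = 2 * d + 2 + (ν - 2 * d - 2) * ((1 + Q * V).det) ^ (-(1 : ℝ) / d))
    (H : Matrix (Fin d) (Fin d) ℝ)
    (hH : H = ((1 + Q * V).det) ^ ((1 : ℝ) / d) • (1 + Q * V)⁻¹)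
    (hint : ∀ i j, Integrable (fun x => (M x * Vbar * (M x)ᵀ) i j) μ) :
    (1 / (v - 2 * d - 2)) •
        Matrix.of (fun i j => ∫ x, (M x * Vbar * (M x)ᵀ) i j ∂μ) =
      Matrix.of (fun i j =>
        ∫ x, (M x * ((1 / (ν - 2 * d - 2)) • V) * H * (M x)ᵀ) i j ∂μ) ∧
      ((1 / (v - 2 * d - 2)) •
          Matrix.of (fun i j => ∫ x, (M x * Vbar * (M x)ᵀ) i j ∂μ)).det =
        (Matrix.of (fun i j =>
          ∫ x, (M x * ((1 / (ν - 2 * d - 2)) • V) * H * (M x)ᵀ) i j ∂μ)).det := by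
  have hD := det_one_add_mul_nonneg hQ hV.posSemidef
  have hc : 1 / (v - 2 * d - 2) =
      1 / (ν - 2 * d - 2) * (1 + Q * V).det ^ ((1 : ℝ) / d) := by
    have hv' : v - 2 * d - 2 = (ν - 2 * d - 2) * ((1 + Q * V).det ^ ((1 : ℝ) / d))⁻¹ := by
      rw [← Real.rpow_neg hD, ← neg_div, hv]
      ring
    rw [hv', one_div, mul_inv, inv_inv, ← one_div]
  have key (x : α) : M x * ((1 / (ν - 2 * d - 2)) • V) * H * (M x)ᵀ =
      (1 / (v - 2 * d - 2)) • (M x * Vbar * (M x)ᵀ) := by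
    rw [hc, hH, hVbar]
    simp only [Matrix.mul_smul, Matrix.smul_mul, smul_smul, Matrix.mul_assoc]
    rw [mul_comm]
  rw [and_iff_left_of_imp (congrArg Matrix.det)]
  ext i j
  simp only [key, Matrix.smul_apply, Matrix.of_apply, smul_eq_mul, integral_const_mul]
end
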